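/- Let M be a 2×2 matrix over the Laurent polynomial ring ℂ[z, z⁻¹] whose determinant is a unit of ℂ[z, z⁻¹] (i.e., of the form c·z^k with c ∈ ℂ^×, k ∈ ℤ). Then there exist integers n ≥ m, a 2×2 matrix P over ℂ[z] whose determinant is a nonzero constant, and a 2×2 matrix Q over ℂ[z⁻¹] whose determinant is a nonzero constant, such that M = P · diag(z^n, z^m) · Q in matrices over ℂ[z, z⁻¹]. Moreover, the pair (n, m) is uniquely determined by M. -/

import Mathlib

open LaurentPolynomial

/-- `BirkhoffFact M n m` says that the 2×2 Laurent-polynomial matrix `M` factors as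
`P · diag(zⁿ, zᵐ) · Q` with `P` a matrix over ℂ[z] with nonzero constant determinant and
`Q` a matrix over ℂ[z⁻¹] (realized as the image of a polynomial matrix under z ↦ z⁻¹)
with nonzero constant determinant. -/
def BirkhoffFact (M : Matrix (Fin 2) (Fin 2) (LaurentPolynomial ℂ)) (n m : ℤ) : Prop :=
  ∃ P Q : Matrix (Fin 2) (Fin 2) (Polynomial ℂ),
    (∃ c : ℂ, c ≠ 0 ∧ P.det = Polynomial.C c) ∧
    (∃ c : ℂ, c ≠ 0 ∧ Q.det = Polynomial.C c) ∧
    M = P.map (Polynomial.toLaurent (R := ℂ)) *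
          Matrix.diagonal ![LaurentPolynomial.T n, LaurentPolynomial.T m] *
          Q.map (Polynomial.aeval (LaurentPolynomial.T (-1) : LaurentPolynomial ℂ))

open Polynomial in
theorem aeval_T_neg_one_eq_invert (q : ℂ[X]) :
    aeval (T (-1) : ℂ[T;T⁻¹]) q = invert (toLaurent q) := by
  induction q using Polynomial.induction_on' with
  | add p q hp hq => simp [hp, hq]
  | monomial n a =>
    rw [← C_mul_X_pow_eq_monomial]
    simp [LaurentPolynomial.T_pow, LaurentPolynomial.algebraMap_apply]

open Polynomial in
theorem coeff_toLaurent_natCast (p : ℂ[X]) (n : ℕ) : (toLaurent p).coeff n = p.coeff n := by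
  rw [coeff_toLaurent]
  exact Finsupp.mapDomain_apply Nat.cast_injective _ _

open Polynomial in
theorem coeff_toLaurent_of_neg (p : ℂ[X]) {a : ℤ} (ha : a < 0) : (toLaurent p).coeff a = 0 := by
  rw [coeff_toLaurent]
  refine Finsupp.mapDomain_of_notMem_range _ _ ?_
  rintro ⟨n, rfl⟩
  simp at ha
  omega

open Polynomial in
theorem eq_zero_of_toLaurent_mul_T_eq {p q : ℂ[X]} {a b : ℤ} (hab : b < a)
    (h : toLaurent p * T a = T b * aeval (T (-1) : ℂ[T;T⁻¹]) q) : p = 0 := by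
  obtain ⟨d, hd⟩ := Int.eq_ofNat_of_zero_le (sub_pos.2 hab).le
  have key : toLaurent (p * X ^ d) = invert (toLaurent q) := by
    rw [← aeval_T_neg_one_eq_invert, map_mul, toLaurent_X_pow, ← hd, sub_eq_add_neg, T_add,
      ← mul_assoc, h, mul_right_comm, ← T_add]
    simp
  have hz : p * X ^ d = 0 := by
    ext n
    rcases Nat.eq_zero_or_pos n with rfl | hn
    · rw [coeff_mul_X_pow', if_neg (by omega), coeff_zero]
    · rw [← coeff_toLaurent_natCast, key, invert_apply, coeff_toLaurent_of_neg _ (by omega),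
        coeff_zero]
  simpa using hz

open Polynomial in
theorem exists_toLaurent_eq_T_mul_aeval {p : ℂ[X]} {i : ℕ} (hp : p.natDegree ≤ i) :
    ∃ q : ℂ[X], toLaurent p = T i * aeval (T (-1) : ℂ[T;T⁻¹]) q := by
  refine induction_with_natDegree_le
    (fun p => ∃ q : ℂ[X], toLaurent p = T i * aeval (T (-1) : ℂ[T;T⁻¹]) q) i
    ⟨0, by simp⟩ ?_ ?_ p hp
  · intro n r _ hn
    refine ⟨Polynomial.C r * X ^ (i - n), ?_⟩
    rw [toLaurent_C_mul_X_pow, aeval_T_neg_one_eq_invert, toLaurent_C_mul_X_pow, map_mul,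
      invert_C, invert_T, mul_left_comm, ← T_add]
    congr 2
    omega
  · rintro f g - - ⟨q, hq⟩ ⟨r, hr⟩
    exact ⟨q + r, by simp [hq, hr, mul_add]⟩

/-- Two Laurent-polynomial matrices define isomorphic bundles on `ℙ¹` when they differ by left
multiplication by `GL₂(ℂ[z])` and right multiplication by `GL₂(ℂ[z⁻¹])`. -/
def ClutchingEquiv (M N : Matrix (Fin 2) (Fin 2) ℂ[T;T⁻¹]) : Prop :=
  ∃ P Q : (Matrix (Fin 2) (Fin 2) (Polynomial ℂ))ˣ,
    M = (Polynomial.toLaurent (R := ℂ)).mapMatrix P.1 * N *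
      (Polynomial.aeval (T (-1) : ℂ[T;T⁻¹])).mapMatrix Q.1

namespace ClutchingEquiv

variable {M N K : Matrix (Fin 2) (Fin 2) ℂ[T;T⁻¹]}

theorem trans (h₁ : ClutchingEquiv M N) (h₂ : ClutchingEquiv N K) : ClutchingEquiv M K := by
  obtain ⟨P, Q, rfl⟩ := h₁
  obtain ⟨P', Q', rfl⟩ := h₂
  exact ⟨P * P', Q' * Q, by simp only [Units.val_mul, map_mul, mul_assoc]⟩

theorem symm (h : ClutchingEquiv M N) : ClutchingEquiv N M := by
  obtain ⟨P, Q, rfl⟩ := h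
  refine ⟨P⁻¹, Q⁻¹, ?_⟩
  simp only [mul_assoc, ← map_mul, Units.mul_inv, map_one, mul_one]
  simp only [← mul_assoc, ← map_mul, Units.inv_mul, map_one, one_mul]

theorem of_isUnit_det {P Q : Matrix (Fin 2) (Fin 2) (Polynomial ℂ)}
    (hP : IsUnit P.det) (hQ : IsUnit Q.det)
    (h : M = P.map (Polynomial.toLaurent (R := ℂ)) * N *
      Q.map (Polynomial.aeval (T (-1) : ℂ[T;T⁻¹]))) :
    ClutchingEquiv M N :=
  ⟨((Matrix.isUnit_iff_isUnit_det P).2 hP).unit, ((Matrix.isUnit_iff_isUnit_det Q).2 hQ).unit, h⟩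

theorem smul_T (h : ClutchingEquiv M N) (k : ℤ) :
    ClutchingEquiv ((T k : ℂ[T;T⁻¹]) • M) ((T k : ℂ[T;T⁻¹]) • N) := by
  obtain ⟨P, Q, rfl⟩ := h
  exact ⟨P, Q, by simp only [Matrix.mul_smul, Matrix.smul_mul]⟩

end ClutchingEquiv

theorem exists_det_eq_C_iff_isUnit (P : Matrix (Fin 2) (Fin 2) (Polynomial ℂ)) :
    (∃ c : ℂ, c ≠ 0 ∧ P.det = Polynomial.C c) ↔ IsUnit P.det := by
  simp only [Polynomial.isUnit_iff, isUnit_iff_ne_zero, eq_comm]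

theorem birkhoffFact_iff {M : Matrix (Fin 2) (Fin 2) ℂ[T;T⁻¹]} {n m : ℤ} :
    BirkhoffFact M n m ↔ ClutchingEquiv M (Matrix.diagonal ![T n, T m]) := by
  constructor
  · rintro ⟨P, Q, hP, hQ, h⟩
    exact .of_isUnit_det ((exists_det_eq_C_iff_isUnit P).1 hP)
      ((exists_det_eq_C_iff_isUnit Q).1 hQ) h
  · rintro ⟨P, Q, h⟩
    exact ⟨P, Q, (exists_det_eq_C_iff_isUnit _).2 ((Matrix.isUnit_iff_isUnit_det _).1 P.isUnit),
      (exists_det_eq_C_iff_isUnit _).2 ((Matrix.isUnit_iff_isUnit_det _).1 Q.isUnit), h⟩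

theorem BirkhoffFact.swap {M : Matrix (Fin 2) (Fin 2) ℂ[T;T⁻¹]} {n m : ℤ}
    (h : BirkhoffFact M n m) : BirkhoffFact M m n := by
  rw [birkhoffFact_iff] at h ⊢
  refine h.trans (.of_isUnit_det (P := !![0, 1; 1, 0]) (Q := !![0, 1; 1, 0])
    (by simp) (by simp) ?_)
  ext i j : 1
  fin_cases i <;> fin_cases j <;> simp [Matrix.mul_apply, Fin.sum_univ_two]

theorem BirkhoffFact.add_eq {M : Matrix (Fin 2) (Fin 2) ℂ[T;T⁻¹]} {n m : ℤ}
    (h : BirkhoffFact M n m) {c : ℂ} {k : ℤ} (hc : c ≠ 0) (hM : M.det = C c * T k) :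
    n + m = k := by
  obtain ⟨P, Q, ⟨a, ha, hP⟩, ⟨b, hb, hQ⟩, rfl⟩ := h
  have h₁ : (P.map (Polynomial.toLaurent (R := ℂ))).det = C a := by
    rw [← RingHom.mapMatrix_apply, ← RingHom.map_det, hP, Polynomial.toLaurent_C]
  have h₂ : (Q.map (Polynomial.aeval (T (-1) : ℂ[T;T⁻¹]))).det = C b := by
    rw [← AlgHom.mapMatrix_apply, ← AlgHom.map_det, hQ, Polynomial.aeval_C, C_eq_algebraMap]
  rw [Matrix.det_mul, Matrix.det_mul, h₁, h₂, Matrix.det_diagonal, Fin.prod_univ_two] at hM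
  have h₃ : C (a * b) * T (n + m) = C c * T k := by
    rw [← hM, map_mul, T_add]
    simp only [Matrix.cons_val_zero, Matrix.cons_val_one]
    ring
  have h₄ := congrArg degree h₃
  rw [degree_C_mul_T _ _ (mul_ne_zero ha hb), degree_C_mul_T _ _ hc] at h₄
  exact_mod_cast h₄

theorem BirkhoffFact.fst_le {M : Matrix (Fin 2) (Fin 2) ℂ[T;T⁻¹]} {n m n' m' : ℤ}
    (h : BirkhoffFact M n m) (h' : BirkhoffFact M n' m') (hle : m' ≤ n') : n ≤ n' := by
  by_contra! hlt
  rw [birkhoffFact_iff] at h h'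
  obtain ⟨P, Q, hPQ⟩ := h'.symm.trans h
  have key : (Polynomial.toLaurent (R := ℂ)).mapMatrix P.1 * Matrix.diagonal ![T n, T m] =
      Matrix.diagonal ![T n', T m'] *
        (Polynomial.aeval (T (-1) : ℂ[T;T⁻¹])).mapMatrix (Q⁻¹).1 := by
    rw [hPQ, mul_assoc, ← map_mul, Units.mul_inv, map_one, mul_one]
  have h0 : P.1 0 0 = 0 :=
    eq_zero_of_toLaurent_mul_T_eq hlt (by simpa using congrFun (congrFun key 0) 0)
  have h1 : P.1 1 0 = 0 :=
    eq_zero_of_toLaurent_mul_T_eq (hle.trans_lt hlt) (by simpa using congrFun (congrFun key 1) 0)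
  have hdet := (Matrix.isUnit_iff_isUnit_det _).1 P.isUnit
  simp [Matrix.det_fin_two, h0, h1] at hdet

open Polynomial in
theorem exists_birkhoffFact_upperTriangular (i j : ℕ) (b : ℂ[X]) :
    ∃ n m : ℤ, BirkhoffFact !![T i, toLaurent b; 0, T j] n m := by
  induction hN : j - i using Nat.strong_induction_on generalizing i j b with
  | _ N ih =>
  subst hN
  have hmonic : (X ^ (i + 1) : ℂ[X]).Monic := monic_X_pow _
  obtain ⟨q, hq⟩ := exists_toLaurent_eq_T_mul_aeval (p := b %ₘ X ^ (i + 1)) (i := i) <| by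
    have := natDegree_modByMonic_lt b hmonic fun h => by
      simpa using congrArg natDegree h
    rw [natDegree_X_pow] at this
    omega
  set b' := b /ₘ X ^ (i + 1)
  have hred : ClutchingEquiv !![T i, toLaurent b; 0, T j]
      !![T i, toLaurent (X ^ (i + 1) * b'); 0, T j] := by
    refine .of_isUnit_det (P := 1) (Q := !![1, q; 0, 1]) (by simp) (by simp) ?_
    have hb : toLaurent b = T i * aeval (T (-1) : ℂ[T;T⁻¹]) q + toLaurent (X ^ (i + 1) * b') := by
      rw [← hq, ← map_add, modByMonic_add_div]
    ext k l : 1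
    fin_cases k <;> fin_cases l <;> simp [Matrix.mul_apply, Fin.sum_univ_two, hb]
  rcases eq_or_ne b' 0 with h0 | h0
  · refine ⟨i, j, birkhoffFact_iff.2 ?_⟩
    convert hred using 1
    ext k l : 1
    fin_cases k <;> fin_cases l <;> simp [h0]
  obtain ⟨r, u, hu, hbu⟩ : ∃ (r : ℕ) (u : ℂ[X]), ¬ X ∣ u ∧ b' = X ^ r * u := by
    obtain ⟨u, hbu, hu⟩ := exists_eq_pow_rootMultiplicity_mul_and_not_dvd b' h0 0
    exact ⟨_, u, by simpa using hu, by simpa using hbu⟩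
  rcases le_or_gt j (i + 1 + r) with hj | hj
  · obtain ⟨f, hf⟩ := Nat.exists_eq_add_of_le hj
    refine ⟨i, j, birkhoffFact_iff.2 (hred.trans ?_)⟩
    refine .of_isUnit_det (P := !![1, X ^ f * u; 0, 1]) (Q := 1) (by simp) (by simp) ?_
    have hb : X ^ (i + 1) * b' = X ^ f * u * X ^ j := by
      rw [hbu, ← mul_assoc, ← pow_add, hf, pow_add]; ring
    ext k l : 1
    fin_cases k <;> fin_cases l <;> simp [Matrix.mul_apply, Fin.sum_univ_two, hb, -map_pow]
  · obtain ⟨f, rfl⟩ := Nat.exists_eq_add_of_lt hj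
    have hcop : IsCoprime u (X ^ (f + 1)) :=
      ((prime_X.coprime_iff_not_dvd.2 hu).symm).pow_right
    obtain ⟨s, t, hst⟩ := hcop
    obtain ⟨n, m, hnm⟩ := ih _ (by omega) (i + 1 + r) (i + f + 1) (s * X ^ i) rfl
    refine ⟨n, m, birkhoffFact_iff.2 (hred.trans (.trans ?_ (birkhoffFact_iff.1 hnm)))⟩
    refine .symm (.of_isUnit_det (P := !![s, t; X ^ (f + 1), -u]) (Q := !![0, 1; 1, 0])
      ?_ (by simp) ?_)
    · rw [Matrix.det_fin_two_of, show s * -u - t * X ^ (f + 1) = -1 by rw [← hst]; ring]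
      exact isUnit_one.neg
    · have hb : X ^ (i + 1) * b' = X ^ (i + 1 + r) * u := by
        rw [hbu]; ring
      have h₁ : s * (X ^ (i + 1) * b') + t * X ^ (i + 1 + r + f + 1) = X ^ (i + 1 + r) := by
        rw [hb]; linear_combination X ^ (i + 1 + r) * hst
      have h₂ : X ^ (f + 1) * (X ^ (i + 1) * b') + -u * X ^ (i + 1 + r + f + 1) = 0 := by
        rw [hb]; ring
      have h₃ : (X : ℂ[X]) ^ (f + 1) * X ^ i = X ^ (i + f + 1) := by ring
      have h₁' := congrArg toLaurent h₁
      have h₂' := congrArg toLaurent h₂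
      have h₃' := congrArg toLaurent h₃
      simp only [map_add, map_mul, toLaurent_X_pow, map_zero] at h₁' h₂' h₃'
      simp only [Nat.cast_add, Nat.cast_one, map_neg, neg_mul] at h₁' h₂' h₃'
      ext k l : 1
      fin_cases k <;> fin_cases l <;>
        simp [Matrix.mul_apply, Fin.sum_univ_two, -T_mul, h₁', h₂', h₃']

open Polynomial in
theorem exists_birkhoffFact_of_polynomial (A : Matrix (Fin 2) (Fin 2) ℂ[X]) {c : ℂ} {k : ℕ}
    (hc : c ≠ 0) (hA : A.det = Polynomial.C c * X ^ k) :
    ∃ n m : ℤ, BirkhoffFact (A.map toLaurent) n m := by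
  have hdet0 : A.det ≠ 0 := by simp [hA, hc]
  have hdvd : A.det ∣ X ^ k :=
    ⟨Polynomial.C c⁻¹, by rw [hA, mul_right_comm, ← Polynomial.C_mul, mul_inv_cancel₀ hc]; simp⟩
  rw [Matrix.det_fin_two] at hdet0 hdvd
  have hg := EuclideanDomain.gcd_eq_gcd_ab (A 0 0) (A 1 0)
  obtain ⟨x, hx⟩ := EuclideanDomain.gcd_dvd_left (A 0 0) (A 1 0)
  obtain ⟨y, hy⟩ := EuclideanDomain.gcd_dvd_right (A 0 0) (A 1 0)
  generalize EuclideanDomain.gcd (A 0 0) (A 1 0) = g at hg hx hy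
  generalize EuclideanDomain.gcdA (A 0 0) (A 1 0) = a at hg
  generalize EuclideanDomain.gcdB (A 0 0) (A 1 0) = b at hg
  have hg0 : g ≠ 0 := by
    rintro rfl
    simp [hx, hy] at hdet0
  have hab : x * a + y * b = 1 := by
    apply mul_left_cancel₀ hg0
    linear_combination -hg - a * hx - b * hy
  have hdet : A 0 0 * A 1 1 - A 0 1 * A 1 0 = g * (x * A 1 1 - y * A 0 1) := by
    linear_combination A 1 1 * hx - A 0 1 * hy
  rw [hdet] at hdvd
  obtain ⟨i, -, v, hv⟩ := (dvd_prime_pow prime_X k).1 ((dvd_mul_right _ _).trans hdvd)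
  obtain ⟨j, -, w, hw⟩ := (dvd_prime_pow prime_X k).1 ((dvd_mul_left _ _).trans hdvd)
  obtain ⟨n, m, h⟩ := exists_birkhoffFact_upperTriangular i j (v * (a * A 0 1 + b * A 1 1))
  refine ⟨n, m, birkhoffFact_iff.2 (.trans (.symm ?_) (birkhoffFact_iff.1 h))⟩
  refine .of_isUnit_det (P := !![v * a, v * b; -(w * y), w * x]) (Q := 1) ?_ (by simp) ?_
  · rw [Matrix.det_fin_two_of, show (v : ℂ[X]) * a * (w * x) - v * b * -(w * y) = v * w by
      linear_combination (v * w : ℂ[X]) * hab]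
    exact v.isUnit.mul w.isUnit
  · have hPA : !![(X : ℂ[X]) ^ i, v * (a * A 0 1 + b * A 1 1); 0, X ^ j] =
        !![v * a, v * b; -(w * y), w * x] * A := by
      ext k l : 1
      fin_cases k <;> fin_cases l <;>
        simp only [Matrix.mul_apply, Fin.sum_univ_two, Fin.zero_eta, Fin.mk_one, Matrix.of_apply,
          Matrix.cons_val', Matrix.cons_val_zero, Matrix.cons_val_one, Matrix.cons_val_fin_one]
      · linear_combination -hv + v * hg
      · ring
      · linear_combination w * y * hx - w * x * hy
      · linear_combination -hw
    have := congrArg (toLaurent (R := ℂ)).mapMatrix hPA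
    rw [map_mul] at this
    simp only [RingHom.mapMatrix_apply] at this
    rw [Matrix.map_one _ (map_zero _) (map_one _), mul_one, ← this]
    ext k l : 1
    fin_cases k <;> fin_cases l <;> simp

open Polynomial in
theorem exists_map_toLaurent_eq_smul (M : Matrix (Fin 2) (Fin 2) ℂ[T;T⁻¹]) :
    ∃ (N : ℕ) (A : Matrix (Fin 2) (Fin 2) ℂ[X]), A.map toLaurent = (T N : ℂ[T;T⁻¹]) • M := by
  choose d f hf using fun i j => exists_T_pow (M i j)
  have hle (i j) : d i j ≤ ∑ i, ∑ j, d i j :=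
    (Finset.single_le_sum (f := d i) (fun _ _ => zero_le) (Finset.mem_univ j)).trans
      (Finset.single_le_sum (f := fun i => ∑ j, d i j) (fun _ _ => zero_le) (Finset.mem_univ i))
  refine ⟨∑ i, ∑ j, d i j, .of fun i j => f i j * X ^ (∑ i, ∑ j, d i j - d i j), ?_⟩
  ext i j : 1
  rw [Matrix.map_apply, Matrix.of_apply, map_mul, hf, toLaurent_X_pow, mul_assoc, ← T_add,
    Nat.cast_sub (hle i j), add_sub_cancel, Matrix.smul_apply, smul_eq_mul, mul_comm]

theorem exists_birkhoffFact (M : Matrix (Fin 2) (Fin 2) ℂ[T;T⁻¹]) {c : ℂ} {k : ℤ} (hc : c ≠ 0)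
    (hM : M.det = C c * T k) : ∃ n m : ℤ, BirkhoffFact M n m := by
  obtain ⟨N, A, hA⟩ := exists_map_toLaurent_eq_smul M
  have hdet : Polynomial.toLaurent A.det = C c * T (2 * N + k) := by
    rw [RingHom.map_det, RingHom.mapMatrix_apply, hA, Matrix.det_smul, hM, Fintype.card_fin,
      T_pow, mul_left_comm, ← T_add]
    rfl
  have hnonneg : 0 ≤ 2 * N + k := by
    by_contra! hneg
    have h := coeff_toLaurent_of_neg A.det hneg
    rw [hdet, ← single_eq_C_mul_T, AddMonoidAlgebra.coeff_single, Finsupp.single_eq_same] at h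
    exact hc h
  obtain ⟨l, hl⟩ := Int.eq_ofNat_of_zero_le hnonneg
  obtain ⟨n, m, h⟩ := exists_birkhoffFact_of_polynomial A (k := l) hc <| by
    apply Polynomial.toLaurent_injective
    rw [hdet, hl, Polynomial.toLaurent_C_mul_X_pow]
  refine ⟨n - N, m - N, birkhoffFact_iff.2 ?_⟩
  have h' := (birkhoffFact_iff.1 h).smul_T (-N)
  rw [hA, smul_smul, ← T_add, neg_add_cancel, T_zero, one_smul] at h'
  convert h' using 1
  ext i j : 1
  fin_cases i <;> fin_cases j <;> simp [-T_mul, sub_eq_neg_add, T_add]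

theorem birkhoff_factorization_rank_two
    (M : Matrix (Fin 2) (Fin 2) (LaurentPolynomial ℂ))
    (hM : ∃ (c : ℂ) (k : ℤ), c ≠ 0 ∧ M.det = LaurentPolynomial.C c * LaurentPolynomial.T k) :
    ∃ n m : ℤ, m ≤ n ∧ BirkhoffFact M n m ∧
      ∀ n' m' : ℤ, m' ≤ n' → BirkhoffFact M n' m' → n' = n ∧ m' = m := by
  obtain ⟨c, k, hc, hdet⟩ := hM
  obtain ⟨n, m, hle, h⟩ : ∃ n m : ℤ, m ≤ n ∧ BirkhoffFact M n m := by
    obtain ⟨n, m, h⟩ := exists_birkhoffFact M hc hdet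
    rcases le_total m n with hle | hle
    · exact ⟨n, m, hle, h⟩
    · exact ⟨m, n, hle, h.swap⟩
  refine ⟨n, m, hle, h, fun n' m' hle' h' => ?_⟩
  have hn : n' = n := le_antisymm (h'.fst_le h hle) (h.fst_le h' hle')
  have hs := h.add_eq hc hdet
  have hs' := h'.add_eq hc hdet
  exact ⟨hn, by omega⟩
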